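/- Assume 1/4 < s' ≤ 1, 1/2 < s ≤ 1, max(3/2 − 2s, s/2 − 1/8) < s' < 4s − 3/2, 1/2 < θ₀ < 3/4, and max(1/2, 1 − s') < θ₁ < min(3/4, 4s − s' − 1, 2s − 1/2). Then there exists ε₀ > 0 such that for every ε with 0 < ε ≤ ε₀ there exists a constant C > 0 such that for all Schwartz functions u, v on ℝ^{1+2}, ‖uv‖_{H^{s−1/2, θ₀−1+ε}} ≤ C ‖u‖_{H^{s−1/2, θ₀}} ‖v‖_{H^{s'+1/2, θ₁−1/2}}. -/

import Mathlib

open MeasureTheory Real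
open scoped FourierTransform

noncomputable section

/-- Space-time ℝ^{1+2}: coordinate 0 is time `t`, coordinates 1,2 are space `x`. -/
abbrev SpaceTime := EuclideanSpace ℝ (Fin 3)

/-- The magnitude `|ξ|` of the spatial part of a frequency point `(τ, ξ) ∈ ℝ × ℝ²`. -/
def spFreq (ζ : SpaceTime) : ℝ := Real.sqrt ((ζ 1) ^ 2 + (ζ 2) ^ 2)

/-- The wave-Sobolev norm
`‖u‖_{H^{s,b}} = (∫ (1+|ξ|²)^s (1+||τ|-|ξ||)^{2b} |û(τ,ξ)|² dτ dξ)^{1/2}`. -/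
def waveNorm (s b : ℝ) (f : SpaceTime → ℂ) : ℝ :=
  (∫ ζ : SpaceTime, (1 + (spFreq ζ) ^ 2) ^ s * (1 + |(|ζ 0| - spFreq ζ)|) ^ (2 * b) *
    ‖𝓕 f ζ‖ ^ 2) ^ (1/2 : ℝ)

open scoped ENNReal

theorem exists_lintegral_sin_rpow_le {p : ℝ} (hp0 : 0 < p) (hp1 : p < 1) :
    ∃ Q : ℝ≥0∞, Q ≠ ⊤ ∧ ∀ β : ℝ, ∫⁻ α in Set.Ioo (-π) π,
      ENNReal.ofReal |sin ((α - β) / 2)| ^ (-p) ≤ Q := by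
  have hinteg : IntegrableOn (fun x : ℝ => (|x| / π) ^ (-p)) (Set.Ioc (-π) π) := by
    rw [← intervalIntegrable_iff_integrableOn_Ioc_of_le (by linarith [pi_pos])]
    have h1 : IntervalIntegrable (fun x : ℝ => (|x| / π) ^ (-p)) volume 0 π := by
      have := (intervalIntegral.intervalIntegrable_rpow' (r := -p) (by linarith)
        (a := 0) (b := π)).div_const (π ^ (-p))
      refine this.congr ?_
      intro x hx
      rw [Set.uIoc_of_le pi_pos.le] at hx
      simp only
      rw [abs_of_pos hx.1, div_rpow hx.1.le pi_pos.le]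
    have h2 : IntervalIntegrable (fun x : ℝ => (|x| / π) ^ (-p)) volume 0 (-π) := by
      rw [IntervalIntegrable.iff_comp_neg]
      simpa using h1
    exact h2.symm.trans h1
  refine ⟨∫⁻ x in Set.Ioc (-π) π, ENNReal.ofReal ((|x| / π) ^ (-p)),
    hinteg.lintegral_lt_top.ne, fun β => ?_⟩
  set q : ℝ → ℝ≥0∞ := fun x => ENNReal.ofReal |sin (x / 2)| ^ (-p) with hq
  have hper : ∀ x, q (x + 2 * π) = q x := by
    intro x
    simp only [hq]
    rw [show (x + 2 * π) / 2 = x / 2 + π by ring, sin_add_pi, abs_neg]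
  have hper' : Function.Periodic q (2 * π) := hper
  calc ∫⁻ α in Set.Ioo (-π) π, q (α - β)
      ≤ ∫⁻ α in Set.Ioc (-π) (-π + 2 * π), q (α - β) :=
        lintegral_mono_set fun x hx => ⟨hx.1, by linarith [hx.2]⟩
    _ = ∫⁻ α in Set.Ioc (β - π) (β - π + 2 * π), q (α - β) := by
        refine (isAddFundamentalDomain_Ioc two_pi_pos (-π)).setLIntegral_eq
          (isAddFundamentalDomain_Ioc two_pi_pos (β - π)) _ ?_
        rintro ⟨g, hg⟩ x
        obtain ⟨n, rfl⟩ := AddSubgroup.mem_zmultiples_iff.1 hg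
        change q (n • (2 * π) + x - β) = q (x - β)
        rw [show n • (2 * π) + x - β = (x - β) + n • (2 * π) by ring]
        exact hper'.zsmul n _
    _ = ∫⁻ x in Set.Ioc (-π) π, q x := by
        rw [← lintegral_indicator measurableSet_Ioc, ← lintegral_indicator measurableSet_Ioc,
          ← lintegral_sub_right_eq_self (Set.indicator (Set.Ioc (-π) π) q) β]
        congr 1
        ext x
        simp only [Set.indicator, Set.mem_Ioc]
        congr 1
        simp only [eq_iff_iff]
        constructor <;> rintro ⟨h1, h2⟩ <;> constructor <;> linarith
    _ ≤ _ := by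
        rw [← lintegral_indicator measurableSet_Ioc, ← lintegral_indicator measurableSet_Ioc]
        refine lintegral_mono_ae ?_
        filter_upwards [Measure.ae_ne volume (0 : ℝ)] with x hx0
        refine Set.indicator_le_indicator' fun hx => ?_
        simp only [hq]
        have hpos : 0 < |x| / π := by positivity
        rw [← ENNReal.ofReal_rpow_of_pos hpos]
        rw [ENNReal.rpow_neg, ENNReal.rpow_neg, ENNReal.inv_le_inv]
        refine ENNReal.rpow_le_rpow (ENNReal.ofReal_le_ofReal ?_) hp0.le
        have := mul_abs_le_abs_sin (x := x / 2)
          (by rw [abs_le]; constructor <;> linarith [hx.1, hx.2])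
        rw [abs_div, abs_two] at this
        calc |x| / π = 2 / π * (|x| / 2) := by ring
          _ ≤ _ := this

theorem ofReal_rpow_neg_le_of_mul_sq_le {b c s z : ℝ} (hb : 0 < b) (hc : 0 < c) (hs : 0 ≤ s)
    (h : c * s ^ 2 ≤ z) :
    ENNReal.ofReal (z ^ (-(2 * b))) ≤
      ENNReal.ofReal (c ^ (-(2 * b))) * ENNReal.ofReal s ^ (-(4 * b)) := by
  rcases hs.eq_or_lt with rfl | hs
  · rw [ENNReal.ofReal_zero, ENNReal.zero_rpow_of_neg (by linarith), ENNReal.mul_top]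
    · exact le_top
    · simpa using rpow_pos_of_pos hc _
  · rw [ENNReal.ofReal_rpow_of_pos hs, ← ENNReal.ofReal_mul (by positivity)]
    refine ENNReal.ofReal_le_ofReal ?_
    calc z ^ (-(2 * b)) ≤ (c * s ^ 2) ^ (-(2 * b)) :=
          rpow_le_rpow_of_nonpos (by positivity) h (by linarith)
      _ = _ := by
          rw [mul_rpow hc.le (by positivity), ← rpow_natCast, ← rpow_mul hs.le]
          congr 2
          push_cast
          ring

theorem abs_cos_sub_cos_mul_le {r ρ c c' m m' : ℝ} (hr : 0 < r) (hrρ : r ≤ ρ)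
    (hm : 0 ≤ m) (hm' : 0 ≤ m') (hmρ : m ≤ ρ + r) (hmρ' : m' ≤ ρ + r)
    (h : m ^ 2 = ρ ^ 2 + r ^ 2 - 2 * ρ * r * c) (h' : m' ^ 2 = ρ ^ 2 + r ^ 2 - 2 * ρ * r * c') :
    r * |c - c'| ≤ 2 * |m - m'| := by
  have h1 : |m - m'| * (m + m') = 2 * ρ * r * |c - c'| := by
    rw [← abs_of_nonneg (add_nonneg hm hm'), ← abs_mul,
      ← abs_of_nonneg (show 0 ≤ 2 * ρ * r by nlinarith), ← abs_mul, ← abs_neg]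
    congr 1
    linarith
  have h2 : |m - m'| * (m + m') ≤ |m - m'| * (4 * ρ) :=
    mul_le_mul_of_nonneg_left (by linarith) (abs_nonneg _)
  have h3 : ρ * (r * |c - c'|) ≤ ρ * (2 * |m - m'|) := by linarith
  exact le_of_mul_le_mul_left h3 (by linarith)

theorem exists_angular_lintegral_le {b : ℝ} (hb0 : 0 < b) (hb1 : b < 1 / 4) :
    ∃ Q : ℝ≥0∞, Q ≠ ⊤ ∧ ∀ τ x y r : ℝ, 0 < r → r ≤ √(x ^ 2 + y ^ 2) →
      ∫⁻ α in Set.Ioo (-π) π, ENNReal.ofReal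
        ((1 + |τ + √((x - r * cos α) ^ 2 + (y - r * sin α) ^ 2)|) ^ (-(2 * b))) ≤
      Q * ENNReal.ofReal ((1 + r) ^ (-(2 * b))) := by
  obtain ⟨Q, hQ, hQle⟩ := exists_lintegral_sin_rpow_le (p := 4 * b) (by linarith) (by linarith)
  refine ⟨ENNReal.ofReal ((1 / 2) ^ (-(2 * b))) * (Q + Q), by finiteness, ?_⟩
  intro τ x y r hr hrρ
  set ρ := √(x ^ 2 + y ^ 2) with hρ
  obtain ⟨β, hx, hy⟩ : ∃ β, x = ρ * cos β ∧ y = ρ * sin β := by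
    refine ⟨Complex.arg ⟨x, y⟩, ?_, ?_⟩
    · have := Complex.norm_mul_cos_arg ⟨x, y⟩
      rw [Complex.norm_eq_sqrt_sq_add_sq] at this
      exact this.symm
    · have := Complex.norm_mul_sin_arg ⟨x, y⟩
      rw [Complex.norm_eq_sqrt_sq_add_sq] at this
      exact this.symm
  set m : ℝ → ℝ := fun α => √((x - r * cos α) ^ 2 + (y - r * sin α) ^ 2) with hm
  have hm0 : ∀ α, 0 ≤ m α := fun α => sqrt_nonneg _
  have hmsq : ∀ α, m α ^ 2 = ρ ^ 2 + r ^ 2 - 2 * ρ * r * cos (α - β) := by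
    intro α
    rw [sq_sqrt (by positivity), cos_sub, hx, hy]
    linear_combination (ρ ^ 2) * cos_sq_add_sin_sq β + (r ^ 2) * cos_sq_add_sin_sq α
  have hmle : ∀ α, m α ≤ ρ + r := by
    intro α
    refine abs_le_of_sq_le_sq' ?_ (by linarith) |>.2
    rw [hmsq]
    nlinarith [neg_one_le_cos (α - β), mul_pos hr (hr.trans_le hrρ)]
  have hcont : Continuous fun α => |τ + m α| := by fun_prop
  obtain ⟨α₀, -, hα₀⟩ := isCompact_Icc.exists_isMinOn
    (Set.nonempty_Icc.2 (by linarith [pi_pos] : -π ≤ π)) hcont.continuousOn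
  have key : ∀ α ∈ Set.Ioo (-π) π, ENNReal.ofReal ((1 + |τ + m α|) ^ (-(2 * b))) ≤
      ENNReal.ofReal ((1 / 2) ^ (-(2 * b))) * ENNReal.ofReal ((1 + r) ^ (-(2 * b))) *
        (ENNReal.ofReal |sin ((α - (2 * β - α₀)) / 2)| ^ (-(4 * b)) +
          ENNReal.ofReal |sin ((α - α₀) / 2)| ^ (-(4 * b))) := by
    intro α hα
    have hmin : |τ + m α₀| ≤ |τ + m α| := hα₀ ⟨hα.1.le, hα.2.le⟩
    have hdiff : |m α - m α₀| ≤ 2 * |τ + m α| := by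
      calc |m α - m α₀| = |(τ + m α) - (τ + m α₀)| := by ring_nf
        _ ≤ |τ + m α| + |τ + m α₀| := abs_sub _ _
        _ ≤ _ := by linarith
    have hcos := abs_cos_sub_cos_mul_le hr hrρ (hm0 α) (hm0 α₀) (hmle α) (hmle α₀)
      (hmsq α) (hmsq α₀)
    have hD : |cos (α - β) - cos (α₀ - β)| =
        2 * (|sin ((α - (2 * β - α₀)) / 2)| * |sin ((α - α₀) / 2)|) := by
      rw [cos_sub_cos, abs_mul, abs_mul, abs_neg, abs_two, mul_assoc]
      ring_nf
    set sA := |sin ((α - (2 * β - α₀)) / 2)|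
    set sB := |sin ((α - α₀) / 2)|
    have hA0 : 0 ≤ sA := abs_nonneg _
    have hB0 : 0 ≤ sB := abs_nonneg _
    have hA1 : sA ≤ 1 := abs_sin_le_one _
    have hB1 : sB ≤ 1 := abs_sin_le_one _
    have hAB : (1 / 2 * (1 + r)) * (sA * sB) ≤ 1 + |τ + m α| := by
      rw [hD] at hcos
      have : sA * sB ≤ 1 := mul_le_one₀ hA1 hB0 hB1
      nlinarith
    have hc : (0 : ℝ) < 1 / 2 * (1 + r) := by positivity
    rw [← ENNReal.ofReal_mul (by positivity), ← mul_rpow (by norm_num) (by positivity), mul_add]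
    rcases le_total sA sB with h | h
    · refine le_trans (ofReal_rpow_neg_le_of_mul_sq_le hb0 hc hA0 ?_) le_self_add
      exact le_trans (mul_le_mul_of_nonneg_left (by nlinarith) hc.le) hAB
    · refine le_trans (ofReal_rpow_neg_le_of_mul_sq_le hb0 hc hB0 ?_) le_add_self
      exact le_trans (mul_le_mul_of_nonneg_left (by nlinarith) hc.le) hAB
  calc _ ≤ ∫⁻ α in Set.Ioo (-π) π,
      ENNReal.ofReal ((1 / 2) ^ (-(2 * b))) * ENNReal.ofReal ((1 + r) ^ (-(2 * b))) *
        (ENNReal.ofReal |sin ((α - (2 * β - α₀)) / 2)| ^ (-(4 * b)) +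
          ENNReal.ofReal |sin ((α - α₀) / 2)| ^ (-(4 * b))) :=
        setLIntegral_mono' measurableSet_Ioo key
    _ = ENNReal.ofReal ((1 / 2) ^ (-(2 * b))) * ENNReal.ofReal ((1 + r) ^ (-(2 * b))) *
        ((∫⁻ α in Set.Ioo (-π) π,
          ENNReal.ofReal |sin ((α - (2 * β - α₀)) / 2)| ^ (-(4 * b))) +
          ∫⁻ α in Set.Ioo (-π) π, ENNReal.ofReal |sin ((α - α₀) / 2)| ^ (-(4 * b))) := by
        rw [lintegral_const_mul' _ _ (by finiteness), lintegral_add_left (by fun_prop)]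
    _ ≤ ENNReal.ofReal ((1 / 2) ^ (-(2 * b))) * ENNReal.ofReal ((1 + r) ^ (-(2 * b))) *
        (Q + Q) := by gcongr <;> apply hQle
    _ = _ := by ring

/-- The symbol `⟨η⟩^{-2σ}` cut off to the disc `|η| ≤ |(x, y)|`. -/
def cutoffWeight (σ x y : ℝ) (η : ℝ × ℝ) : ℝ≥0∞ :=
  if η.1 ^ 2 + η.2 ^ 2 ≤ x ^ 2 + y ^ 2 then
    ENNReal.ofReal ((1 + (η.1 ^ 2 + η.2 ^ 2)) ^ (-σ)) else 0

@[fun_prop]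
theorem measurable_cutoffWeight (σ x y : ℝ) : Measurable (cutoffWeight σ x y) := by
  unfold cutoffWeight
  exact Measurable.ite (measurableSet_le (by fun_prop) (by fun_prop)) (by fun_prop) (by fun_prop)

theorem mul_rpow_japanese_le {σ b r : ℝ} (hσ : 0 ≤ σ) (hr : 0 < r) :
    r * (1 + r ^ 2) ^ (-σ) * (1 + r) ^ (-(2 * b)) ≤
      2 ^ σ * (1 + r) ^ (-(2 * σ + 2 * b - 1)) := by
  have h1 : (1 + r ^ 2) ^ (-σ) ≤ 2 ^ σ * (1 + r) ^ (-(2 * σ)) := by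
    calc (1 + r ^ 2) ^ (-σ) ≤ (2⁻¹ * (1 + r) ^ 2) ^ (-σ) :=
          rpow_le_rpow_of_nonpos (by positivity) (by nlinarith [sq_nonneg (1 - r)]) (by linarith)
      _ = _ := by
          rw [mul_rpow (by norm_num) (by positivity), inv_rpow (by norm_num),
            rpow_neg (by norm_num), inv_inv, ← rpow_natCast, ← rpow_mul (by positivity)]
          congr 2
          push_cast
          ring
  calc r * (1 + r ^ 2) ^ (-σ) * (1 + r) ^ (-(2 * b))
      ≤ (1 + r) * (2 ^ σ * (1 + r) ^ (-(2 * σ))) * (1 + r) ^ (-(2 * b)) := by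
        gcongr
        linarith
    _ = 2 ^ σ * ((1 + r) ^ (1 : ℝ) * (1 + r) ^ (-(2 * σ)) * (1 + r) ^ (-(2 * b))) := by
        rw [rpow_one]
        ring
    _ = _ := by
        rw [← rpow_add (by positivity), ← rpow_add (by positivity)]
        ring_nf

theorem exists_lintegral_cutoffWeight_le {σ b : ℝ} (hσ : 0 ≤ σ) (hb0 : 0 < b) (hb1 : b < 1 / 4)
    (hσb : 1 < σ + b) :
    ∃ K : ℝ≥0∞, K ≠ ⊤ ∧ ∀ τ x y ε : ℝ,
      ∫⁻ η : ℝ × ℝ, cutoffWeight σ x y η * ENNReal.ofReal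
        ((1 + |τ + ε * √(η.1 ^ 2 + η.2 ^ 2) + √((x - η.1) ^ 2 + (y - η.2) ^ 2)|) ^ (-(2 * b))) ≤
      K := by
  obtain ⟨Q, hQ, hQle⟩ := exists_angular_lintegral_le hb0 hb1
  have hJ : ∫⁻ r : ℝ, ENNReal.ofReal ((1 + ‖r‖) ^ (-(2 * σ + 2 * b - 1))) < ⊤ :=
    finite_integral_one_add_norm (by simp; linarith)
  refine ⟨Q * (ENNReal.ofReal (2 ^ σ) *
    ∫⁻ r : ℝ, ENNReal.ofReal ((1 + ‖r‖) ^ (-(2 * σ + 2 * b - 1)))), by finiteness, ?_⟩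
  intro τ x y ε
  rw [← lintegral_comp_polarCoord_symm]
  simp only [polarCoord_target, polarCoord_symm_apply, smul_eq_mul]
  rw [Measure.volume_eq_prod, ← Measure.prod_restrict, lintegral_prod _ (by fun_prop)]
  calc _ ≤ ∫⁻ r in Set.Ioi (0 : ℝ), Q * (ENNReal.ofReal (2 ^ σ) *
        ENNReal.ofReal ((1 + ‖r‖) ^ (-(2 * σ + 2 * b - 1)))) := by
        refine setLIntegral_mono' measurableSet_Ioi fun r hr => ?_
        have hr : 0 < r := hr
        have hsq : ∀ α, (r * cos α) ^ 2 + (r * sin α) ^ 2 = r ^ 2 := fun α => by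
          linear_combination r ^ 2 * cos_sq_add_sin_sq α
        simp only [cutoffWeight, hsq, sqrt_sq hr.le]
        split_ifs with h
        · have hrρ : r ≤ √(x ^ 2 + y ^ 2) := le_sqrt_of_sq_le h
          calc _ = ENNReal.ofReal r * ENNReal.ofReal ((1 + r ^ 2) ^ (-σ)) *
                ∫⁻ α in Set.Ioo (-π) π, ENNReal.ofReal ((1 + |(τ + ε * r) +
                  √((x - r * cos α) ^ 2 + (y - r * sin α) ^ 2)|) ^ (-(2 * b))) := by
                rw [← lintegral_const_mul _ (by fun_prop)]
                simp only [mul_assoc]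
            _ ≤ ENNReal.ofReal r * ENNReal.ofReal ((1 + r ^ 2) ^ (-σ)) *
                (Q * ENNReal.ofReal ((1 + r) ^ (-(2 * b)))) := by
                gcongr
                exact hQle _ _ _ _ hr hrρ
            _ = Q * ENNReal.ofReal (r * (1 + r ^ 2) ^ (-σ) * (1 + r) ^ (-(2 * b))) := by
                rw [ENNReal.ofReal_mul (by positivity), ENNReal.ofReal_mul (by positivity)]
                ring
            _ ≤ _ := by
                rw [← ENNReal.ofReal_mul (by positivity), norm_of_nonneg hr.le]
                gcongr Q * ENNReal.ofReal ?_
                exact mul_rpow_japanese_le hσ hr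
        · simp
    _ ≤ ∫⁻ r : ℝ, Q * (ENNReal.ofReal (2 ^ σ) *
        ENNReal.ofReal ((1 + ‖r‖) ^ (-(2 * σ + 2 * b - 1)))) := setLIntegral_le_lintegral _ _
    _ = _ := by
        rw [lintegral_const_mul' _ _ hQ, lintegral_const_mul' _ _ (by finiteness)]

/-- The decaying weight `⟨x⟩^{-p}`, with `⟨x⟩ = 1 + |x|`. -/
def bracketDecay (p x : ℝ) : ℝ≥0∞ := ENNReal.ofReal ((1 + |x|) ^ (-p))

@[fun_prop]
theorem measurable_bracketDecay (p : ℝ) : Measurable (bracketDecay p) := by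
  unfold bracketDecay
  fun_prop

theorem bracketDecay_neg (p x : ℝ) : bracketDecay p (-x) = bracketDecay p x := by
  simp [bracketDecay]

theorem bracketDecay_abs_sub_le (p s a : ℝ) :
    bracketDecay p (|s| - a) ≤ bracketDecay p (s + 1 * a) + bracketDecay p (s + -1 * a) := by
  rcases abs_choice s with h | h <;> rw [h]
  · refine le_trans (le_of_eq ?_) le_add_self
    ring_nf
  · refine le_trans (le_of_eq ?_) le_self_add
    rw [← bracketDecay_neg]
    ring_nf

theorem lintegral_bracketDecay_lt_top {p : ℝ} (hp : 1 < p) : ∫⁻ s : ℝ, bracketDecay p s < ⊤ :=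
  finite_integral_one_add_norm (by simpa using hp)

theorem lintegral_modulation_le {X : Type*} [MeasureSpace X] [SFinite (volume : Measure X)]
    {ω : X → ℝ≥0∞} {a c : X → ℝ} (hω : Measurable ω) (ha : Measurable a) (hc : Measurable c)
    {p q : ℝ} {K : ℝ≥0∞}
    (hK : ∀ τ ε₁ ε₂ : ℝ, ε₁ ^ 2 = 1 → ε₂ ^ 2 = 1 →
      ∫⁻ x, ω x * bracketDecay q (τ + ε₁ * a x + ε₂ * c x) ≤ K) (t : ℝ) :
    ∫⁻ z : ℝ × X, ω z.2 * bracketDecay p (|z.1| - a z.2) *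
        bracketDecay q (|t + z.1| - c z.2) ≤ 4 * ((∫⁻ s : ℝ, bracketDecay p s) * K) := by
  have main : ∀ ε₁ ε₂ : ℝ, ε₁ ^ 2 = 1 → ε₂ ^ 2 = 1 →
      ∫⁻ z : ℝ × X, ω z.2 * bracketDecay p (z.1 + ε₁ * a z.2) *
        bracketDecay q (t + z.1 + ε₂ * c z.2) ≤
        (∫⁻ s : ℝ, bracketDecay p s) * K := by
    intro ε₁ ε₂ h₁ h₂
    calc ∫⁻ z : ℝ × X, ω z.2 * bracketDecay p (z.1 + ε₁ * a z.2) *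
        bracketDecay q (t + z.1 + ε₂ * c z.2)
        = ∫⁻ x, ∫⁻ s : ℝ, ω x * bracketDecay p (s + ε₁ * a x) *
            bracketDecay q (t + s + ε₂ * c x) := by
          rw [Measure.volume_eq_prod, lintegral_prod_symm _ (by fun_prop)]
      _ = ∫⁻ x, ∫⁻ s : ℝ, bracketDecay p s *
            (ω x * bracketDecay q ((t + s) + -ε₁ * a x + ε₂ * c x)) := by
          refine lintegral_congr fun x => ?_
          rw [← lintegral_sub_right_eq_self _ (ε₁ * a x)]
          refine lintegral_congr fun s => ?_
          rw [show s - ε₁ * a x + ε₁ * a x = s by ring,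
            show t + (s - ε₁ * a x) + ε₂ * c x = t + s + -ε₁ * a x + ε₂ * c x by ring]
          ring
      _ = ∫⁻ s : ℝ, ∫⁻ x, bracketDecay p s *
            (ω x * bracketDecay q ((t + s) + -ε₁ * a x + ε₂ * c x)) :=
          lintegral_lintegral_swap (by unfold Function.uncurry; fun_prop)
      _ ≤ ∫⁻ s : ℝ, bracketDecay p s * K := by
          refine lintegral_mono fun s => ?_
          rw [lintegral_const_mul _ (by fun_prop)]
          gcongr
          exact hK _ _ _ (by rw [neg_sq, h₁]) h₂
      _ = _ := lintegral_mul_const _ (by fun_prop)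
  calc _ ≤ ∫⁻ z : ℝ × X,
        ((ω z.2 * bracketDecay p (z.1 + 1 * a z.2) * bracketDecay q (t + z.1 + 1 * c z.2) +
        ω z.2 * bracketDecay p (z.1 + 1 * a z.2) * bracketDecay q (t + z.1 + -1 * c z.2)) +
        (ω z.2 * bracketDecay p (z.1 + -1 * a z.2) * bracketDecay q (t + z.1 + 1 * c z.2) +
        ω z.2 * bracketDecay p (z.1 + -1 * a z.2) * bracketDecay q (t + z.1 + -1 * c z.2))) := by
        refine lintegral_mono fun z => ?_
        refine le_trans (mul_le_mul' (mul_le_mul' le_rfl (bracketDecay_abs_sub_le p z.1 (a z.2)))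
          (bracketDecay_abs_sub_le q (t + z.1) (c z.2))) (le_of_eq ?_)
        ring
    _ ≤ ((∫⁻ s : ℝ, bracketDecay p s) * K + (∫⁻ s : ℝ, bracketDecay p s) * K) +
        ((∫⁻ s : ℝ, bracketDecay p s) * K + (∫⁻ s : ℝ, bracketDecay p s) * K) := by
        rw [lintegral_add_left (by fun_prop), lintegral_add_left (by fun_prop),
          lintegral_add_left (by fun_prop)]
        gcongr <;> exact main _ _ (by norm_num) (by norm_num)
    _ = _ := by ring

theorem lintegral_spaceTime {f : ℝ × (ℝ × ℝ) → ℝ≥0∞} (hf : Measurable f) :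
    ∫⁻ ζ : SpaceTime, f (ζ 0, ζ 1, ζ 2) = ∫⁻ p, f p := by
  have h1 := EuclideanSpace.volume_preserving_symm_measurableEquiv_toLp (Fin 3)
  have h2 := volume_preserving_piFinSuccAbove (fun _ : Fin 3 => ℝ) 0
  have h3 := (MeasurePreserving.id (volume : Measure ℝ)).prod (volume_preserving_finTwoArrow ℝ)
  exact (h3.comp (h2.comp h1)).lintegral_comp hf

/-- The symbol `⟨η⟩^{-2σ}` cut off to spatial frequencies `|η| ≤ |ζ|`. -/
def lowWeight (σ : ℝ) (ζ η : SpaceTime) : ℝ≥0∞ :=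
  if spFreq η ≤ spFreq ζ then ENNReal.ofReal ((1 + spFreq η ^ 2) ^ (-σ)) else 0

theorem lowWeight_eq_cutoffWeight (σ : ℝ) (ζ η : SpaceTime) :
    lowWeight σ ζ η = cutoffWeight σ (ζ 1) (ζ 2) (η 1, η 2) := by
  unfold lowWeight cutoffWeight spFreq
  rw [sq_sqrt (by positivity)]
  simp only [sqrt_le_sqrt_iff (show (0 : ℝ) ≤ ζ 1 ^ 2 + ζ 2 ^ 2 by positivity)]

@[fun_prop]
theorem continuous_spFreq : Continuous spFreq := by
  unfold spFreq
  fun_prop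

theorem spFreq_neg (ζ : SpaceTime) : spFreq (-ζ) = spFreq ζ := by
  simp [spFreq]

theorem exists_signed_lintegral_cutoffWeight_le {σ b : ℝ} (hσ : 0 ≤ σ) (hb0 : 0 < b)
    (hb1 : b < 1 / 4) (hσb : 1 < σ + b) :
    ∃ K : ℝ≥0∞, K ≠ ⊤ ∧ ∀ x y τ ε₁ ε₂ : ℝ, ε₂ ^ 2 = 1 →
      ∫⁻ η : ℝ × ℝ, cutoffWeight σ x y η * bracketDecay (2 * b)
        (τ + ε₁ * √(η.1 ^ 2 + η.2 ^ 2) + ε₂ * √((x - η.1) ^ 2 + (y - η.2) ^ 2)) ≤ K := by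
  obtain ⟨K, hK, hKle⟩ := exists_lintegral_cutoffWeight_le hσ hb0 hb1 hσb
  refine ⟨K, hK, fun x y τ ε₁ ε₂ h₂ => ?_⟩
  rcases sq_eq_sq_iff_eq_or_eq_neg.1 (h₂.trans (one_pow 2).symm) with rfl | rfl
  · simpa [bracketDecay] using hKle τ x y ε₁
  · refine le_trans (le_of_eq (lintegral_congr fun η => ?_)) (hKle (-τ) x y (-ε₁))
    rw [← bracketDecay_neg, bracketDecay]
    ring_nf

theorem exists_lintegral_lowWeight_sub_le {σ b β : ℝ} (hσ : 0 ≤ σ) (hb0 : 0 < b)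
    (hb1 : b < 1 / 4) (hσb : 1 < σ + b) (hβ : 1 / 2 < β) :
    ∃ K : ℝ≥0∞, K ≠ ⊤ ∧ ∀ ζ : SpaceTime,
      ∫⁻ η : SpaceTime, lowWeight σ ζ (ζ - η) * bracketDecay (2 * β) (|η 0| - spFreq η) *
        bracketDecay (2 * b) (|(ζ - η) 0| - spFreq (ζ - η)) ≤ K := by
  obtain ⟨K, hK, hKle⟩ := exists_signed_lintegral_cutoffWeight_le hσ hb0 hb1 hσb
  have hL := lintegral_bracketDecay_lt_top (p := 2 * β) (by linarith)
  refine ⟨4 * ((∫⁻ s : ℝ, bracketDecay (2 * β) s) * K), by finiteness, fun ζ => ?_⟩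
  have := lintegral_modulation_le (X := ℝ × ℝ)
    (ω := fun η => cutoffWeight σ (ζ 1) (ζ 2) (ζ 1 - η.1, ζ 2 - η.2))
    (a := fun η => √(η.1 ^ 2 + η.2 ^ 2))
    (c := fun η => √((ζ 1 - η.1) ^ 2 + (ζ 2 - η.2) ^ 2)) (by fun_prop) (by fun_prop)
    (by fun_prop) (p := 2 * β) (q := 2 * b) (K := K) ?_ (-ζ 0)
  · refine le_trans (le_of_eq ?_) this
    rw [← lintegral_spaceTime (by fun_prop)]
    refine lintegral_congr fun η => ?_
    rw [lowWeight_eq_cutoffWeight]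
    simp only [spFreq, PiLp.sub_apply]
    rw [← abs_neg (ζ 0 - η 0)]
    ring_nf
  · intro τ ε₁ ε₂ h₁ h₂
    refine le_trans (le_of_eq ?_) (hKle (ζ 1) (ζ 2) τ ε₂ ε₁ h₁)
    rw [← lintegral_sub_left_eq_self _ (ζ 1, ζ 2)]
    refine lintegral_congr fun η => ?_
    simp only [Prod.fst_sub, Prod.snd_sub]
    ring_nf

theorem exists_lintegral_lowWeight_le {σ b β : ℝ} (hσ : 0 ≤ σ) (hb0 : 0 < b)
    (hb1 : b < 1 / 4) (hσb : 1 < σ + b) (hβ : 1 / 2 < β) :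
    ∃ K : ℝ≥0∞, K ≠ ⊤ ∧ ∀ ζ : SpaceTime,
      ∫⁻ η : SpaceTime, lowWeight σ ζ η * bracketDecay (2 * β) (|η 0| - spFreq η) *
        bracketDecay (2 * b) (|(ζ - η) 0| - spFreq (ζ - η)) ≤ K := by
  obtain ⟨K, hK, hKle⟩ := exists_signed_lintegral_cutoffWeight_le hσ hb0 hb1 hσb
  have hL := lintegral_bracketDecay_lt_top (p := 2 * β) (by linarith)
  refine ⟨4 * ((∫⁻ s : ℝ, bracketDecay (2 * β) s) * K), by finiteness, fun ζ => ?_⟩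
  have := lintegral_modulation_le (X := ℝ × ℝ)
    (ω := cutoffWeight σ (ζ 1) (ζ 2))
    (a := fun η => √(η.1 ^ 2 + η.2 ^ 2))
    (c := fun η => √((ζ 1 - η.1) ^ 2 + (ζ 2 - η.2) ^ 2)) (by fun_prop) (by fun_prop)
    (by fun_prop) (p := 2 * β) (q := 2 * b) (K := K)
    (fun τ ε₁ ε₂ _ h₂ => hKle (ζ 1) (ζ 2) τ ε₁ ε₂ h₂) (-ζ 0)
  refine le_trans (le_of_eq ?_) this
  rw [← lintegral_spaceTime (by fun_prop)]
  refine lintegral_congr fun η => ?_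
  rw [lowWeight_eq_cutoffWeight]
  simp only [spFreq, PiLp.sub_apply]
  rw [← abs_neg (ζ 0 - η 0)]
  ring_nf

theorem bracketDecay_sq (p x : ℝ) : bracketDecay p x ^ 2 = bracketDecay (2 * p) x := by
  rw [bracketDecay, bracketDecay, ← ENNReal.ofReal_pow (by positivity), ← rpow_natCast,
    ← rpow_mul (by positivity)]
  congr 2
  push_cast
  ring

theorem lowWeight_sq (σ : ℝ) (ζ η : SpaceTime) :
    lowWeight σ ζ η ^ 2 = lowWeight (2 * σ) ζ η := by
  unfold lowWeight
  split_ifs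
  · rw [← ENNReal.ofReal_pow (by positivity), ← rpow_natCast, ← rpow_mul (by positivity)]
    congr 2
    push_cast
    ring
  · simp

theorem measurable_uncurry_lowWeight (σ : ℝ) :
    Measurable fun z : SpaceTime × SpaceTime => lowWeight σ z.1 z.2 := by
  unfold lowWeight
  exact Measurable.ite (measurableSet_le (by fun_prop) (by fun_prop)) (by fun_prop) (by fun_prop)

@[fun_prop]
theorem measurable_lowWeight {X : Type*} [MeasurableSpace X] (σ : ℝ) {f g : X → SpaceTime}
    (hf : Measurable f) (hg : Measurable g) : Measurable fun x => lowWeight σ (f x) (g x) :=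
  (measurable_uncurry_lowWeight σ).comp (hf.prodMk hg)

theorem sq_lintegral_mul_le {X : Type*} [MeasurableSpace X] {μ : Measure X} {f g : X → ℝ≥0∞}
    (hf : AEMeasurable f μ) (hg : AEMeasurable g μ) :
    (∫⁻ x, f x * g x ∂μ) ^ 2 ≤ (∫⁻ x, f x ^ 2 ∂μ) * ∫⁻ x, g x ^ 2 ∂μ := by
  have h := ENNReal.lintegral_mul_le_Lp_mul_Lq μ Real.HolderConjugate.two_two hf hg
  simp only [ENNReal.rpow_two, Pi.mul_apply] at h
  calc _ ≤ _ := pow_le_pow_left₀ zero_le h 2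
    _ = _ := by
      rw [mul_pow, ← ENNReal.rpow_natCast, ← ENNReal.rpow_natCast, ← ENNReal.rpow_mul,
        ← ENNReal.rpow_mul]
      norm_num

/-- A Schur-type bound: a trilinear convolution form is controlled by the `L²` norms as soon as
the kernel is square integrable in one variable, uniformly in the other. -/
theorem sq_lintegral_trilinear_le {k : SpaceTime → SpaceTime → ℝ≥0∞}
    (hk : Measurable (Function.uncurry k)) {F G H : SpaceTime → ℝ≥0∞} (hF : Measurable F)
    (hG : Measurable G) (hH : Measurable H) {A : ℝ≥0∞} (hA : ∀ x, ∫⁻ y, k x y ^ 2 ≤ A) :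
    (∫⁻ x, H x * ∫⁻ y, k x y * F y * G (x - y)) ^ 2 ≤
      A * ((∫⁻ x, F x ^ 2) * (∫⁻ x, G x ^ 2) * ∫⁻ x, H x ^ 2) := by
  have hk' : Measurable fun z : SpaceTime × SpaceTime => k z.1 z.2 := hk
  have hkx : ∀ x, Measurable (k x) := fun x => hk.of_uncurry_left
  have hT : Measurable fun x => ∫⁻ y, k x y * F y * G (x - y) :=
    Measurable.lintegral_prod_right' (f := fun z : SpaceTime × SpaceTime =>
      k z.1 z.2 * F z.2 * G (z.1 - z.2)) (by fun_prop)
  have h1 : ∫⁻ x, (∫⁻ y, k x y * F y * G (x - y)) ^ 2 ≤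
      A * ((∫⁻ x, F x ^ 2) * ∫⁻ x, G x ^ 2) := by
    calc _ ≤ ∫⁻ x, A * ∫⁻ y, F y ^ 2 * G (x - y) ^ 2 := by
          refine lintegral_mono fun x => ?_
          simp only [mul_assoc]
          refine (sq_lintegral_mul_le (hkx x).aemeasurable (by fun_prop)).trans ?_
          simp only [mul_pow]
          gcongr
          exact hA x
      _ = A * ∫⁻ x, ∫⁻ y, F y ^ 2 * G (x - y) ^ 2 :=
          lintegral_const_mul _ (Measurable.lintegral_prod_right'
            (f := fun z : SpaceTime × SpaceTime => F z.2 ^ 2 * G (z.1 - z.2) ^ 2) (by fun_prop))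
      _ = A * ∫⁻ y, ∫⁻ x, F y ^ 2 * G (x - y) ^ 2 := by
          rw [lintegral_lintegral_swap (by unfold Function.uncurry; fun_prop)]
      _ = A * ∫⁻ y, F y ^ 2 * ∫⁻ x, G x ^ 2 := by
          congr 1
          refine lintegral_congr fun y => ?_
          rw [lintegral_const_mul _ (by fun_prop),
            lintegral_sub_right_eq_self (fun x => G x ^ 2) y]
      _ = _ := by rw [lintegral_mul_const _ (by fun_prop)]
  calc _ ≤ _ := sq_lintegral_mul_le hH.aemeasurable hT.aemeasurable
    _ ≤ (∫⁻ x, H x ^ 2) * (A * ((∫⁻ x, F x ^ 2) * ∫⁻ x, G x ^ 2)) := by gcongr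
    _ = _ := by ring

theorem lintegral_trilinear_change_variables {k : SpaceTime → SpaceTime → ℝ≥0∞}
    (hk : Measurable (Function.uncurry k)) {F G H : SpaceTime → ℝ≥0∞} (hF : Measurable F)
    (hG : Measurable G) (hH : Measurable H) :
    ∫⁻ x, H x * ∫⁻ y, k (x - y) (-y) * F y * G (x - y) =
      ∫⁻ z, G z * ∫⁻ y, k z y * F (-y) * H (z - y) := by
  have hk' : Measurable fun z : SpaceTime × SpaceTime => k z.1 z.2 := hk
  have hkc : ∀ {X : Type} [MeasurableSpace X] {f g : X → SpaceTime}, Measurable f →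
      Measurable g → Measurable fun x => k (f x) (g x) := fun hf hg =>
    hk'.comp (hf.prodMk hg)
  calc ∫⁻ x, H x * ∫⁻ y, k (x - y) (-y) * F y * G (x - y)
      = ∫⁻ x, ∫⁻ y, H x * (k (x - y) (-y) * F y * G (x - y)) := by
        refine lintegral_congr fun x => (lintegral_const_mul _ ?_).symm
        exact ((hkc (by fun_prop) (by fun_prop)).mul hF).mul (by fun_prop)
    _ = ∫⁻ y, ∫⁻ x, H x * (k (x - y) (-y) * F y * G (x - y)) := by
        refine lintegral_lintegral_swap (Measurable.aemeasurable ?_)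
        exact Measurable.mul (by fun_prop) (((hkc (by fun_prop) (by fun_prop)).mul
          (by fun_prop)).mul (by fun_prop))
    _ = ∫⁻ y, ∫⁻ z, H (z + y) * (k z (-y) * F y * G z) := by
        refine lintegral_congr fun y => ?_
        rw [← lintegral_add_right_eq_self _ y]
        simp only [add_sub_cancel_right]
    _ = ∫⁻ y, ∫⁻ z, H (z - y) * (k z y * F (-y) * G z) := by
        rw [← lintegral_neg_eq_self]
        simp only [neg_neg, ← sub_eq_add_neg]
    _ = ∫⁻ z, ∫⁻ y, H (z - y) * (k z y * F (-y) * G z) := by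
        refine lintegral_lintegral_swap (Measurable.aemeasurable ?_)
        exact Measurable.mul (by fun_prop) (((hkc (by fun_prop) (by fun_prop)).mul
          (by fun_prop)).mul (by fun_prop))
    _ = _ := by
        refine lintegral_congr fun z => ?_
        have hm : Measurable fun y => k z y * F (-y) * H (z - y) :=
          ((hkc (by fun_prop) (by fun_prop)).mul (by fun_prop)).mul (by fun_prop)
        rw [← lintegral_const_mul _ hm]
        refine lintegral_congr fun y => ?_
        ring

open scoped Convolution in
theorem fourier_mul_eq_convolution (u v : SchwartzMap SpaceTime ℂ) (ζ : SpaceTime) :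
    𝓕 (fun x => u x * v x) ζ = ∫ η, 𝓕 (u : SpaceTime → ℂ) η * 𝓕 (v : SpaceTime → ℂ) (ζ - η) := by
  have h := SchwartzMap.convolution_apply (ContinuousLinearMap.mul ℂ ℂ) (𝓕 u) (𝓕 v) ζ
  have hneg : ∀ (w : SchwartzMap SpaceTime ℂ) (x : SpaceTime), 𝓕 (𝓕 w) x = w (-x) := by
    intro w x
    have h2 : 𝓕⁻ (𝓕 w) (-x) = w (-x) := by rw [FourierTransform.fourierInv_fourier_eq]
    rw [← h2, SchwartzMap.fourierInv_coe, Real.fourierInv_eq_fourier_neg, neg_neg,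
      SchwartzMap.fourier_coe]
  have h3 : SchwartzMap.convolution (ContinuousLinearMap.mul ℂ ℂ) (𝓕 u) (𝓕 v) ζ =
      𝓕 (fun x => u x * v x) ζ := by
    change 𝓕⁻ (SchwartzMap.pairing (ContinuousLinearMap.mul ℂ ℂ) (𝓕 (𝓕 u)) (𝓕 (𝓕 v))) ζ = _
    rw [SchwartzMap.fourierInv_coe, Real.fourierInv_eq_fourier_comp_neg]
    refine congrArg (fun g : SpaceTime → ℂ => 𝓕 g ζ) (funext fun x => ?_)
    simp only [SchwartzMap.pairing_apply_apply, hneg, neg_neg, ContinuousLinearMap.mul_apply']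
  rw [← h3, h, convolution_def]
  rfl

/-- The square root of the weight in the wave-Sobolev norm. -/
def waveWeight (s b : ℝ) (ζ : SpaceTime) : ℝ :=
  (1 + spFreq ζ ^ 2) ^ (s / 2) * (1 + |(|ζ 0| - spFreq ζ)|) ^ b

theorem waveWeight_nonneg (s b : ℝ) (ζ : SpaceTime) : 0 ≤ waveWeight s b ζ := by
  unfold waveWeight
  positivity

@[fun_prop]
theorem measurable_waveWeight (s b : ℝ) : Measurable (waveWeight s b) := by
  unfold waveWeight
  fun_prop

theorem waveWeight_sq (s b : ℝ) (ζ : SpaceTime) :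
    waveWeight s b ζ ^ 2 =
      (1 + spFreq ζ ^ 2) ^ s * (1 + |(|ζ 0| - spFreq ζ)|) ^ (2 * b) := by
  have h : ∀ x p : ℝ, 0 ≤ x → (x ^ p) ^ 2 = x ^ (2 * p) := fun x p hx => by
    rw [mul_comm, rpow_mul hx, rpow_two]
  rw [waveWeight, mul_pow, h _ _ (by positivity), h _ _ (by positivity), mul_div_cancel₀ s two_ne_zero]

/-- The square of the wave-Sobolev norm as a lower integral. -/
def waveEnergy (s b : ℝ) (f : SpaceTime → ℂ) : ℝ≥0∞ :=
  ∫⁻ ζ, (ENNReal.ofReal (waveWeight s b ζ) * ‖𝓕 f ζ‖ₑ) ^ 2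

theorem waveNorm_eq_sqrt_waveEnergy (s b : ℝ) {f : SpaceTime → ℂ} (hf : Measurable (𝓕 f)) :
    waveNorm s b f = √(waveEnergy s b f).toReal := by
  unfold waveNorm waveEnergy
  rw [← sqrt_eq_rpow, integral_eq_lintegral_of_nonneg_ae]
  · congr 2
    refine lintegral_congr fun ζ => ?_
    rw [← waveWeight_sq, ← mul_pow, ENNReal.ofReal_pow
      (mul_nonneg (waveWeight_nonneg _ _ _) (norm_nonneg _)),
      ENNReal.ofReal_mul (waveWeight_nonneg _ _ _), ofReal_norm]
  · exact Filter.Eventually.of_forall fun ζ => by positivity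
  · exact Measurable.aestronglyMeasurable (by fun_prop)

theorem spFreq_nonneg (ζ : SpaceTime) : 0 ≤ spFreq ζ := sqrt_nonneg _

theorem spFreq_le_norm (ζ : SpaceTime) : spFreq ζ ≤ ‖ζ‖ := by
  rw [spFreq, EuclideanSpace.norm_eq]
  refine sqrt_le_sqrt ?_
  simp only [Fin.sum_univ_three, norm_eq_abs, sq_abs]
  nlinarith [sq_nonneg (ζ 0)]

theorem abs_modulation_le_norm (ζ : SpaceTime) : |(|ζ 0| - spFreq ζ)| ≤ ‖ζ‖ := by
  have h0 : |ζ 0| ≤ ‖ζ‖ := PiLp.norm_apply_le ζ 0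
  have h1 := spFreq_le_norm ζ
  have h2 := spFreq_nonneg ζ
  have h3 := abs_nonneg (ζ 0)
  rw [abs_le]
  constructor <;> linarith

theorem exists_waveWeight_le (s b : ℝ) : ∃ n : ℕ, ∀ ζ, waveWeight s b ζ ≤ (1 + ‖ζ‖) ^ n := by
  obtain ⟨n, hn⟩ := exists_nat_ge (max (s / 2) 0)
  obtain ⟨k, hk⟩ := exists_nat_ge (max b 0)
  refine ⟨2 * n + k, fun ζ => ?_⟩
  have h1 := spFreq_le_norm ζ
  have h2 := spFreq_nonneg ζ
  unfold waveWeight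
  rw [pow_add, pow_mul]
  gcongr ?_ * ?_
  · calc (1 + spFreq ζ ^ 2) ^ (s / 2) ≤ (1 + spFreq ζ ^ 2) ^ (n : ℝ) :=
          rpow_le_rpow_of_exponent_le (by nlinarith) ((le_max_left _ _).trans hn)
      _ ≤ _ := by
          rw [rpow_natCast]
          gcongr
          nlinarith
  · calc (1 + |(|ζ 0| - spFreq ζ)|) ^ b ≤ (1 + |(|ζ 0| - spFreq ζ)|) ^ (k : ℝ) :=
          rpow_le_rpow_of_exponent_le (by linarith [abs_nonneg (|ζ 0| - spFreq ζ)])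
            ((le_max_left _ _).trans hk)
      _ ≤ _ := by
          rw [rpow_natCast]
          gcongr
          exact abs_modulation_le_norm ζ

theorem waveEnergy_ne_top (s b : ℝ) (f : SchwartzMap SpaceTime ℂ) :
    waveEnergy s b (fun x => f x) ≠ ⊤ := by
  obtain ⟨n, hn⟩ := exists_waveWeight_le s b
  set g : SchwartzMap SpaceTime ℂ := 𝓕 f with hg
  set M := SchwartzMap.seminorm ℝ 0 0 g
  have hbound : ∀ ζ, (waveWeight s b ζ * ‖g ζ‖) ^ 2 ≤
      M * 2 ^ (2 * n) * (‖ζ‖ ^ 0 * ‖g ζ‖ + ‖ζ‖ ^ (2 * n) * ‖g ζ‖) := by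
    intro ζ
    have hM : ‖g ζ‖ ≤ M := SchwartzMap.norm_le_seminorm ℝ g ζ
    have hM0 : 0 ≤ M := (norm_nonneg _).trans hM
    have hpow : (1 + ‖ζ‖) ^ (2 * n) ≤ 2 ^ (2 * n) * (1 + ‖ζ‖ ^ (2 * n)) := by
      rcases le_total ‖ζ‖ 1 with h | h
      · calc (1 + ‖ζ‖) ^ (2 * n) ≤ 2 ^ (2 * n) := by gcongr; linarith
          _ ≤ _ := le_mul_of_one_le_right (by positivity) (by simp)
      · calc (1 + ‖ζ‖) ^ (2 * n) ≤ (2 * ‖ζ‖) ^ (2 * n) := by gcongr; linarith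
          _ = 2 ^ (2 * n) * ‖ζ‖ ^ (2 * n) := mul_pow _ _ _
          _ ≤ _ := by gcongr; linarith
    calc (waveWeight s b ζ * ‖g ζ‖) ^ 2 = waveWeight s b ζ ^ 2 * (‖g ζ‖ * ‖g ζ‖) := by ring
      _ ≤ ((1 + ‖ζ‖) ^ n) ^ 2 * (M * ‖g ζ‖) := by
          gcongr
          · exact waveWeight_nonneg _ _ _
          · exact hn ζ
      _ = (1 + ‖ζ‖) ^ (2 * n) * (M * ‖g ζ‖) := by ring
      _ ≤ 2 ^ (2 * n) * (1 + ‖ζ‖ ^ (2 * n)) * (M * ‖g ζ‖) := by gcongr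
      _ = _ := by ring
  have hinteg : Integrable fun ζ => M * 2 ^ (2 * n) *
      (‖ζ‖ ^ 0 * ‖g ζ‖ + ‖ζ‖ ^ (2 * n) * ‖g ζ‖) :=
    ((g.integrable_pow_mul volume 0).add (g.integrable_pow_mul volume (2 * n))).const_mul _
  refine ne_top_of_le_ne_top hinteg.lintegral_lt_top.ne (lintegral_mono fun ζ => ?_)
  refine le_trans (le_of_eq ?_) (ENNReal.ofReal_le_ofReal (hbound ζ))
  rw [ENNReal.ofReal_pow (mul_nonneg (waveWeight_nonneg _ _ _) (norm_nonneg _)),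
    ENNReal.ofReal_mul (waveWeight_nonneg _ _ _), ofReal_norm]
  rfl

theorem spFreq_add_le (ζ η : SpaceTime) : spFreq (ζ + η) ≤ spFreq ζ + spFreq η := by
  have h : ∀ z : SpaceTime, spFreq z = ‖(⟨z 1, z 2⟩ : ℂ)‖ := fun z => by
    rw [Complex.norm_eq_sqrt_sq_add_sq, spFreq]
  rw [h, h, h]
  refine le_trans (le_of_eq ?_) (norm_add_le _ _)
  congr 1

theorem rpow_le_four_mul_rpow {J J' p : ℝ} (hJ : 0 < J) (h : J ≤ 4 * J') (hp : 0 ≤ p) :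
    J ^ p ≤ 4 ^ p * J' ^ p := by
  rw [← mul_rpow (by norm_num) (by linarith)]
  exact rpow_le_rpow hJ.le h hp

theorem rpow_mul_rpow_le_of_second_low {s σ β b b' J₀ J₁ J₂ m₀ m₁ m₂ : ℝ} (hs : 0 ≤ s)
    (hb' : 0 ≤ b') (hJ₀ : 0 < J₀) (hJ₂ : 0 < J₂) (hm₀ : 1 ≤ m₀)
    (hm₁ : 0 < m₁) (hm₂ : 0 < m₂) (h : J₀ ≤ 4 * J₁) :
    J₀ ^ (s / 2) * m₀ ^ (-b') ≤ 4 ^ (s / 2) *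
      (J₂ ^ (-(σ / 2)) * m₁ ^ (-β) * m₂ ^ (-b)) *
        ((J₁ ^ (s / 2) * m₁ ^ β) * (J₂ ^ (σ / 2) * m₂ ^ b)) := by
  have h1 : m₀ ^ (-b') ≤ 1 := rpow_le_one_of_one_le_of_nonpos hm₀ (by linarith)
  have h2 := rpow_le_four_mul_rpow (p := s / 2) hJ₀ h (by positivity)
  have hpos := rpow_pos_of_pos hJ₀ (s / 2)
  calc J₀ ^ (s / 2) * m₀ ^ (-b') ≤ 4 ^ (s / 2) * J₁ ^ (s / 2) := by nlinarith
    _ = _ := by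
      rw [rpow_neg hJ₂.le, rpow_neg hm₁.le, rpow_neg hm₂.le]
      have := (rpow_pos_of_pos hJ₂ (σ / 2)).ne'
      have := (rpow_pos_of_pos hm₁ β).ne'
      have := (rpow_pos_of_pos hm₂ b).ne'
      field_simp

theorem rpow_mul_rpow_le_of_output_low {s σ β b b' b₂ J₀ J₁ J₂ m₀ m₁ m₂ : ℝ} (hs : 0 ≤ s)
    (hσ : 0 ≤ σ) (hb₂ : 0 ≤ b₂) (hb : b ≤ b') (hJ₀ : 0 < J₀) (hm₀ : 1 ≤ m₀)
    (hm₁ : 0 < m₁) (hm₂ : 1 ≤ m₂) (h₁ : J₀ ≤ J₁) (h₂ : J₀ ≤ J₂) :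
    J₀ ^ (s / 2) * m₀ ^ (-b') ≤ 4 ^ (s / 2) *
      (J₀ ^ (-(σ / 2)) * m₁ ^ (-β) * m₀ ^ (-b)) *
        ((J₁ ^ (s / 2) * m₁ ^ β) * (J₂ ^ (σ / 2) * m₂ ^ b₂)) := by
  have h0 : J₀ ^ (s / 2) ≤ 4 ^ (s / 2) * J₁ ^ (s / 2) :=
    rpow_le_four_mul_rpow hJ₀ (by linarith) (by positivity)
  have h3 : m₀ ^ (-b') ≤ m₀ ^ (-b) := rpow_le_rpow_of_exponent_le hm₀ (by linarith)
  have h4 : 1 ≤ m₂ ^ b₂ := one_le_rpow hm₂ hb₂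
  have h5 : 1 ≤ J₀ ^ (-(σ / 2)) * J₂ ^ (σ / 2) := by
    rw [rpow_neg hJ₀.le, inv_mul_eq_div, one_le_div (rpow_pos_of_pos hJ₀ _)]
    exact rpow_le_rpow hJ₀.le h₂ (by positivity)
  have h6 : 1 ≤ (J₀ ^ (-(σ / 2)) * J₂ ^ (σ / 2)) * m₂ ^ b₂ := one_le_mul_of_one_le_of_one_le h5 h4
  have hm₀' : 0 < m₀ := by linarith
  have hJ₁' : 0 < J₁ := by linarith
  calc J₀ ^ (s / 2) * m₀ ^ (-b') ≤ (4 ^ (s / 2) * J₁ ^ (s / 2)) * m₀ ^ (-b) := by gcongr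
    _ ≤ (4 ^ (s / 2) * J₁ ^ (s / 2)) * m₀ ^ (-b) *
        ((J₀ ^ (-(σ / 2)) * J₂ ^ (σ / 2)) * m₂ ^ b₂) :=
      le_mul_of_one_le_right (by positivity) h6
    _ = _ := by
      rw [rpow_neg hm₁.le]
      have := (rpow_pos_of_pos hm₁ β).ne'
      field_simp

theorem rpow_mul_rpow_le_of_first_low {s σ β b b' b₂ J₀ J₁ J₂ m₀ m₁ m₂ : ℝ} (hs : 0 ≤ s)
    (hσ : s ≤ σ) (hb₂ : 0 ≤ b₂) (hb : b ≤ b') (hJ₀ : 0 < J₀) (hJ₁ : 0 < J₁) (hm₀ : 1 ≤ m₀)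
    (hm₁ : 0 < m₁) (hm₂ : 1 ≤ m₂) (h₁ : J₀ ≤ 4 * J₂) (h₂ : J₁ ≤ J₂) :
    J₀ ^ (s / 2) * m₀ ^ (-b') ≤ 4 ^ (s / 2) *
      (J₁ ^ (-(σ / 2)) * m₁ ^ (-β) * m₀ ^ (-b)) *
        ((J₁ ^ (s / 2) * m₁ ^ β) * (J₂ ^ (σ / 2) * m₂ ^ b₂)) := by
  have h0 : J₀ ^ (s / 2) ≤ 4 ^ (s / 2) * J₂ ^ (s / 2) :=
    rpow_le_four_mul_rpow hJ₀ h₁ (by positivity)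
  have h3 : m₀ ^ (-b') ≤ m₀ ^ (-b) := rpow_le_rpow_of_exponent_le hm₀ (by linarith)
  have h4 : 1 ≤ m₂ ^ b₂ := one_le_rpow hm₂ hb₂
  have hJ₂ : 0 < J₂ := by linarith
  have h5 : J₂ ^ (s / 2) ≤ J₁ ^ (-(σ / 2)) * J₁ ^ (s / 2) * J₂ ^ (σ / 2) := by
    have h : 1 ≤ (J₂ / J₁) ^ (σ / 2 - s / 2) :=
      one_le_rpow ((one_le_div hJ₁).2 h₂) (by linarith)
    calc J₂ ^ (s / 2) ≤ J₂ ^ (s / 2) * (J₂ / J₁) ^ (σ / 2 - s / 2) :=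
          le_mul_of_one_le_right (by positivity) h
      _ = _ := by
        rw [div_rpow hJ₂.le hJ₁.le, rpow_sub hJ₂, rpow_sub hJ₁, rpow_neg hJ₁.le]
        have := (rpow_pos_of_pos hJ₂ (s / 2)).ne'
        have := (rpow_pos_of_pos hJ₁ (s / 2)).ne'
        have := (rpow_pos_of_pos hJ₁ (σ / 2)).ne'
        field_simp
  have hm₀' : 0 < m₀ := by linarith
  calc J₀ ^ (s / 2) * m₀ ^ (-b') ≤ (4 ^ (s / 2) * J₂ ^ (s / 2)) * m₀ ^ (-b) := by gcongr
    _ ≤ (4 ^ (s / 2) * (J₁ ^ (-(σ / 2)) * J₁ ^ (s / 2) * J₂ ^ (σ / 2))) * m₀ ^ (-b) := by gcongr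
    _ ≤ (4 ^ (s / 2) * (J₁ ^ (-(σ / 2)) * J₁ ^ (s / 2) * J₂ ^ (σ / 2))) * m₀ ^ (-b) *
        m₂ ^ b₂ := le_mul_of_one_le_right (by positivity) h4
    _ = _ := by
      rw [rpow_neg hm₁.le β]
      have := (rpow_pos_of_pos hm₁ β).ne'
      field_simp

theorem ofReal_mul_lowWeight_mul_bracketDecay {σ p q x y C w w' : ℝ} {ζ η : SpaceTime}
    (h : spFreq η ≤ spFreq ζ) (hC : 0 ≤ C) (hw : 0 ≤ w) :
    ENNReal.ofReal C * (lowWeight σ ζ η * bracketDecay p x * bracketDecay q y) *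
        (ENNReal.ofReal w * ENNReal.ofReal w') =
      ENNReal.ofReal (C * ((1 + spFreq η ^ 2) ^ (-σ) * (1 + |x|) ^ (-p) * (1 + |y|) ^ (-q)) *
        (w * w')) := by
  rw [lowWeight, if_pos h, bracketDecay, bracketDecay, ENNReal.ofReal_mul (by positivity),
    ENNReal.ofReal_mul hC, ENNReal.ofReal_mul (by positivity), ENNReal.ofReal_mul (by positivity),
    ENNReal.ofReal_mul hw]

theorem ofReal_waveWeight_add_le {s σ β b b' b₂ : ℝ} (hs : 0 ≤ s) (hσ : s ≤ σ) (hb₂ : 0 ≤ b₂)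
    (hb0 : 0 ≤ b) (hb : b ≤ b') (ζ η : SpaceTime) :
    ENNReal.ofReal (waveWeight s (-b') (ζ + η)) ≤ ENNReal.ofReal (4 ^ (s / 2)) *
      (lowWeight (σ / 2) (ζ + η) η * bracketDecay β (|ζ 0| - spFreq ζ) *
          bracketDecay b₂ (|η 0| - spFreq η) +
        (lowWeight (σ / 2) η (ζ + η) * bracketDecay β (|ζ 0| - spFreq ζ) *
          bracketDecay b (|(ζ + η) 0| - spFreq (ζ + η)) +
        lowWeight (σ / 2) η ζ * bracketDecay β (|ζ 0| - spFreq ζ) *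
          bracketDecay b (|(ζ + η) 0| - spFreq (ζ + η)))) *
      (ENNReal.ofReal (waveWeight s β ζ) * ENNReal.ofReal (waveWeight σ b₂ η)) := by
  have h0 := spFreq_nonneg (ζ + η)
  have h1 := spFreq_nonneg ζ
  have h2 := spFreq_nonneg η
  have h3 := spFreq_add_le ζ η
  have hm : ∀ x : ℝ, 1 ≤ 1 + |x| := fun x => le_add_of_nonneg_right (abs_nonneg x)
  have hC : (0 : ℝ) ≤ 4 ^ (s / 2) := by positivity
  have hw := waveWeight_nonneg s β ζ
  by_cases hζ : spFreq η ≤ spFreq ζ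
  · by_cases hη : spFreq η ≤ spFreq (ζ + η)
    · refine le_trans ?_ (mul_le_mul_left (mul_le_mul_right le_self_add _) _)
      rw [ofReal_mul_lowWeight_mul_bracketDecay hη hC hw]
      refine ENNReal.ofReal_le_ofReal (rpow_mul_rpow_le_of_second_low hs (hb0.trans hb)
        (by positivity) (by positivity) (hm _) (by positivity) (by positivity) ?_)
      nlinarith
    · refine le_trans ?_ (mul_le_mul_left (mul_le_mul_right (le_self_add.trans le_add_self) _) _)
      rw [ofReal_mul_lowWeight_mul_bracketDecay (le_of_not_ge hη) hC hw]
      refine ENNReal.ofReal_le_ofReal (rpow_mul_rpow_le_of_output_low hs (hs.trans hσ) hb₂ hb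
        (by positivity) (hm _) (by positivity) (hm _) ?_ ?_) <;> nlinarith
  · by_cases hη : spFreq (ζ + η) ≤ spFreq ζ
    · refine le_trans ?_ (mul_le_mul_left (mul_le_mul_right (le_self_add.trans le_add_self) _) _)
      rw [ofReal_mul_lowWeight_mul_bracketDecay (by linarith) hC hw]
      refine ENNReal.ofReal_le_ofReal (rpow_mul_rpow_le_of_output_low hs (hs.trans hσ) hb₂ hb
        (by positivity) (hm _) (by positivity) (hm _) ?_ ?_) <;> nlinarith
    · refine le_trans ?_ (mul_le_mul_left (mul_le_mul_right (le_add_self.trans le_add_self) _) _)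
      rw [ofReal_mul_lowWeight_mul_bracketDecay (by linarith) hC hw]
      refine ENNReal.ofReal_le_ofReal (rpow_mul_rpow_le_of_first_low hs hσ hb₂ hb
        (by positivity) (by positivity) (hm _) (by positivity) (hm _) ?_ ?_) <;> nlinarith

theorem exists_sq_lintegral_second_low_le {σ b β : ℝ} (hσ : 0 ≤ σ) (hb0 : 0 < b) (hb1 : b < 1 / 4)
    (hσb : 1 < σ + b) (hβ : 1 / 2 < β) :
    ∃ K : ℝ≥0∞, K ≠ ⊤ ∧ ∀ F G H : SpaceTime → ℝ≥0∞, Measurable F → Measurable G → Measurable H →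
      (∫⁻ x, H x * ∫⁻ y, lowWeight (σ / 2) x (x - y) * bracketDecay β (|y 0| - spFreq y) *
        bracketDecay b (|(x - y) 0| - spFreq (x - y)) * F y * G (x - y)) ^ 2 ≤
        K * ((∫⁻ x, F x ^ 2) * (∫⁻ x, G x ^ 2) * ∫⁻ x, H x ^ 2) := by
  obtain ⟨K, hK, h⟩ := exists_lintegral_lowWeight_sub_le hσ hb0 hb1 hσb hβ
  refine ⟨K, hK, fun F G H hF hG hH => sq_lintegral_trilinear_le
    (k := fun x y => lowWeight (σ / 2) x (x - y) * bracketDecay β (|y 0| - spFreq y) *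
        bracketDecay b (|(x - y) 0| - spFreq (x - y))) (by unfold Function.uncurry; fun_prop)
    hF hG hH fun x => ?_⟩
  simpa only [mul_pow, bracketDecay_sq, lowWeight_sq, mul_div_cancel₀ σ (two_ne_zero' ℝ)] using h x

theorem exists_sq_lintegral_output_low_le {σ b β : ℝ} (hσ : 0 ≤ σ) (hb0 : 0 < b) (hb1 : b < 1 / 4)
    (hσb : 1 < σ + b) (hβ : 1 / 2 < β) :
    ∃ K : ℝ≥0∞, K ≠ ⊤ ∧ ∀ F G H : SpaceTime → ℝ≥0∞, Measurable F → Measurable G → Measurable H →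
      (∫⁻ x, H x * ∫⁻ y, lowWeight (σ / 2) (x - y) x * bracketDecay β (|y 0| - spFreq y) *
        bracketDecay b (|x 0| - spFreq x) * F y * G (x - y)) ^ 2 ≤
        K * ((∫⁻ x, F x ^ 2) * (∫⁻ x, G x ^ 2) * ∫⁻ x, H x ^ 2) := by
  obtain ⟨K, hK, h⟩ := exists_sq_lintegral_second_low_le hσ hb0 hb1 hσb hβ
  refine ⟨K, hK, fun F G H hF hG hH => ?_⟩
  have h1 := h (fun y => F (-y)) H G (by fun_prop) hH hG
  rw [← lintegral_trilinear_change_variables (k := fun x y => lowWeight (σ / 2) x (x - y) *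
      bracketDecay β (|y 0| - spFreq y) * bracketDecay b (|(x - y) 0| - spFreq (x - y)))
      (by unfold Function.uncurry; fun_prop) hF hG hH,
    lintegral_neg_eq_self (fun y => F y ^ 2), mul_right_comm] at h1
  simpa only [sub_neg_eq_add, sub_add_cancel, spFreq_neg, PiLp.neg_apply, abs_neg] using h1

theorem exists_sq_lintegral_first_low_le {σ b β : ℝ} (hσ : 0 ≤ σ) (hb0 : 0 < b) (hb1 : b < 1 / 4)
    (hσb : 1 < σ + b) (hβ : 1 / 2 < β) :
    ∃ K : ℝ≥0∞, K ≠ ⊤ ∧ ∀ F G H : SpaceTime → ℝ≥0∞, Measurable F → Measurable G → Measurable H →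
      (∫⁻ x, H x * ∫⁻ y, lowWeight (σ / 2) (x - y) y * bracketDecay β (|y 0| - spFreq y) *
        bracketDecay b (|x 0| - spFreq x) * F y * G (x - y)) ^ 2 ≤
        K * ((∫⁻ x, F x ^ 2) * (∫⁻ x, G x ^ 2) * ∫⁻ x, H x ^ 2) := by
  obtain ⟨K, hK, h⟩ := exists_lintegral_lowWeight_le hσ hb0 hb1 hσb hβ
  have hk : Measurable (Function.uncurry fun x y => lowWeight (σ / 2) x y *
      bracketDecay β (|y 0| - spFreq y) * bracketDecay b (|(x - y) 0| - spFreq (x - y))) := by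
    unfold Function.uncurry
    fun_prop
  refine ⟨K, hK, fun F G H hF hG hH => ?_⟩
  have h1 := sq_lintegral_trilinear_le hk (F := fun y => F (-y)) (G := H) (H := G) (A := K)
    (by fun_prop) hH hG fun x => by
      simpa only [mul_pow, bracketDecay_sq, lowWeight_sq, mul_div_cancel₀ σ (two_ne_zero' ℝ)]
        using h x
  rw [← lintegral_trilinear_change_variables hk hF hG hH,
    lintegral_neg_eq_self (fun y => F y ^ 2), mul_right_comm] at h1
  have hneg : ∀ x y : SpaceTime, lowWeight (σ / 2) x (-y) = lowWeight (σ / 2) x y := fun x y => by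
    simp only [lowWeight, spFreq_neg]
  simpa only [hneg, sub_neg_eq_add, sub_add_cancel, spFreq_neg, PiLp.neg_apply, abs_neg] using h1

theorem measurable_fourier (f : SchwartzMap SpaceTime ℂ) : Measurable (𝓕 (f : SpaceTime → ℂ)) := by
  rw [← SchwartzMap.fourier_coe]
  exact (𝓕 f).continuous.measurable

theorem measurable_fourier_mul (u v : SchwartzMap SpaceTime ℂ) :
    Measurable (𝓕 fun x => u x * v x) :=
  measurable_fourier (SchwartzMap.pairing (ContinuousLinearMap.mul ℂ ℂ) u v)

theorem waveEnergy_mul_ne_top (s b : ℝ) (u v : SchwartzMap SpaceTime ℂ) :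
    waveEnergy s b (fun x => u x * v x) ≠ ⊤ :=
  waveEnergy_ne_top s b (SchwartzMap.pairing (ContinuousLinearMap.mul ℂ ℂ) u v)

theorem exists_waveEnergy_mul_le {s σ β b b' b₂ : ℝ} (hs : 0 ≤ s) (hσ : s ≤ σ) (hβ : 1 / 2 < β)
    (hb₂0 : 0 < b₂) (hb₂1 : b₂ < 1 / 4) (hσb₂ : 1 < σ + b₂) (hb0 : 0 < b) (hb1 : b < 1 / 4)
    (hσb : 1 < σ + b) (hb : b ≤ b') :
    ∃ K : ℝ≥0∞, K ≠ ⊤ ∧ ∀ u v : SchwartzMap SpaceTime ℂ,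
      waveEnergy s (-b') (fun x => u x * v x) ≤
        K * (waveEnergy s β (fun x => u x) * waveEnergy σ b₂ (fun x => v x)) := by
  obtain ⟨K₂, hK₂, h₂⟩ := exists_sq_lintegral_second_low_le (hs.trans hσ) hb₂0 hb₂1 hσb₂ hβ
  obtain ⟨K₀, hK₀, h₀⟩ := exists_sq_lintegral_output_low_le (hs.trans hσ) hb0 hb1 hσb hβ
  obtain ⟨K₁, hK₁, h₁⟩ := exists_sq_lintegral_first_low_le (hs.trans hσ) hb0 hb1 hσb hβ
  set C := ENNReal.ofReal (4 ^ (s / 2))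
  set K := K₂ + (K₀ + K₁)
  have hK : K ≠ ⊤ := by finiteness
  refine ⟨(C * 3) ^ 2 * K, by finiteness, fun u v => ?_⟩
  set N := waveEnergy s (-b') (fun x => u x * v x) 
  set I := waveEnergy s β (fun x => u x) * waveEnergy σ b₂ (fun x => v x)
  have hNtop : N ≠ ⊤ := waveEnergy_mul_ne_top _ _ u v
  set F : SpaceTime → ℝ≥0∞ := fun ζ => ENNReal.ofReal (waveWeight s β ζ) *
    ‖𝓕 (u : SpaceTime → ℂ) ζ‖ₑ with hFdef
  set G : SpaceTime → ℝ≥0∞ := fun ζ => ENNReal.ofReal (waveWeight σ b₂ ζ) *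
    ‖𝓕 (v : SpaceTime → ℂ) ζ‖ₑ with hGdef
  set H : SpaceTime → ℝ≥0∞ := fun ζ => ENNReal.ofReal (waveWeight s (-b') ζ) *
    ‖𝓕 (fun x => u x * v x) ζ‖ₑ with hHdef
  have hu := measurable_fourier u
  have hv := measurable_fourier v
  have hF : Measurable F := by fun_prop
  have hG : Measurable G := by fun_prop
  have hH : Measurable H := by
    have := measurable_fourier_mul u v
    fun_prop
  set k₂ : SpaceTime → SpaceTime → ℝ≥0∞ := fun x y => lowWeight (σ / 2) x (x - y) *
    bracketDecay β (|y 0| - spFreq y) * bracketDecay b₂ (|(x - y) 0| - spFreq (x - y))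
  set k₀ : SpaceTime → SpaceTime → ℝ≥0∞ := fun x y => lowWeight (σ / 2) (x - y) x *
    bracketDecay β (|y 0| - spFreq y) * bracketDecay b (|x 0| - spFreq x)
  set k₁ : SpaceTime → SpaceTime → ℝ≥0∞ := fun x y => lowWeight (σ / 2) (x - y) y *
    bracketDecay β (|y 0| - spFreq y) * bracketDecay b (|x 0| - spFreq x)
  have hpt : ∀ x, H x ≤ C * ((∫⁻ y, k₂ x y * F y * G (x - y)) +
      ((∫⁻ y, k₀ x y * F y * G (x - y)) + ∫⁻ y, k₁ x y * F y * G (x - y))) := by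
    intro x
    have hmeas : ∀ k : SpaceTime → SpaceTime → ℝ≥0∞, Measurable (k x) →
        Measurable fun y => k x y * F y * G (x - y) := fun k hk => by fun_prop
    rw [← lintegral_add_left (hmeas k₀ (by fun_prop)), ← lintegral_add_left (hmeas k₂ (by fun_prop)),
      ← lintegral_const_mul _ (by fun_prop), hHdef]
    simp only
    rw [fourier_mul_eq_convolution]
    refine (mul_le_mul_right (enorm_integral_le_lintegral_enorm _) _).trans ?_
    rw [← lintegral_const_mul _ (by fun_prop)]
    refine lintegral_mono fun y => ?_
    have h := ofReal_waveWeight_add_le (β := β) hs hσ hb₂0.le hb0.le hb y (x - y)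
    rw [add_sub_cancel] at h
    calc _ ≤ C * (k₂ x y + (k₀ x y + k₁ x y)) * (ENNReal.ofReal (waveWeight s β y) *
          ENNReal.ofReal (waveWeight σ b₂ (x - y))) *
          ‖𝓕 (u : SpaceTime → ℂ) y * 𝓕 (v : SpaceTime → ℂ) (x - y)‖ₑ := mul_le_mul_left h _
      _ = _ := by
        rw [enorm_mul, hFdef, hGdef]
        ring
  have hmono : N ≤ C * ((∫⁻ x, H x * ∫⁻ y, k₂ x y * F y * G (x - y)) +
      ((∫⁻ x, H x * ∫⁻ y, k₀ x y * F y * G (x - y)) +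
        ∫⁻ x, H x * ∫⁻ y, k₁ x y * F y * G (x - y))) := by
    have hmeas : ∀ k : SpaceTime → SpaceTime → ℝ≥0∞, Measurable (Function.uncurry k) →
        Measurable fun x => H x * ∫⁻ y, k x y * F y * G (x - y) := fun k hk => by
      have : Measurable fun z : SpaceTime × SpaceTime => k z.1 z.2 := hk
      refine hH.mul (Measurable.lintegral_prod_right' (f := fun z : SpaceTime × SpaceTime =>
        k z.1 z.2 * F z.2 * G (z.1 - z.2)) (by fun_prop))
    have hm₂ := hmeas k₂ (by unfold Function.uncurry; fun_prop)
    have hm₀ := hmeas k₀ (by unfold Function.uncurry; fun_prop)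
    have hm₁ := hmeas k₁ (by unfold Function.uncurry; fun_prop)
    rw [← lintegral_add_left hm₀, ← lintegral_add_left hm₂,
      ← lintegral_const_mul' _ _ ENNReal.ofReal_ne_top]
    refine lintegral_mono fun x => ?_
    exact (sq (H x)).trans_le ((mul_le_mul_right (hpt x) _).trans_eq (by ring))
  obtain ⟨R, hR⟩ : ∃ R : ℝ≥0∞, R ^ 2 = K * (I * N) :=
    ⟨(K * (I * N)) ^ (1 / 2 : ℝ), by rw [← ENNReal.rpow_natCast, ← ENNReal.rpow_mul]; norm_num⟩
  have hroot : ∀ {T L : ℝ≥0∞}, T ^ 2 ≤ L * (I * N) → L ≤ K → T ≤ R := fun hT hL => by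
    rw [← ENNReal.pow_le_pow_left_iff two_ne_zero, hR]
    exact hT.trans (mul_le_mul_left hL _)
  have hle : N ≤ C * 3 * R := by
    refine hmono.trans ?_
    rw [mul_assoc, show 3 * R = R + (R + R) by ring]
    refine mul_le_mul_right (add_le_add (hroot (h₂ F G H hF hG hH) le_self_add) (add_le_add
      (hroot (h₀ F G H hF hG hH) (le_self_add.trans le_add_self))
      (hroot (h₁ F G H hF hG hH) (le_add_self.trans le_add_self)))) _
  rcases eq_or_ne N 0 with h0 | h0
  · simp [h0]
  · rw [← ENNReal.mul_le_mul_iff_left h0 hNtop]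
    calc N * N = N ^ 2 := (sq N).symm
      _ ≤ (C * 3 * R) ^ 2 := by gcongr
      _ = _ := by
        rw [mul_pow, hR]
        ring

theorem exists_waveNorm_mul_le {s σ β b b' b₂ : ℝ} (hs : 0 ≤ s) (hσ : s ≤ σ) (hβ : 1 / 2 < β)
    (hb₂0 : 0 < b₂) (hb₂1 : b₂ < 1 / 4) (hσb₂ : 1 < σ + b₂) (hb0 : 0 < b) (hb1 : b < 1 / 4)
    (hσb : 1 < σ + b) (hb : b ≤ b') :
    ∃ C > 0, ∀ u v : SchwartzMap SpaceTime ℂ, waveNorm s (-b') (fun x => u x * v x) ≤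
      C * waveNorm s β (fun x => u x) * waveNorm σ b₂ (fun x => v x) := by
  obtain ⟨K, hK, h⟩ := exists_waveEnergy_mul_le hs hσ hβ hb₂0 hb₂1 hσb₂ hb0 hb1 hσb hb
  refine ⟨√(K.toReal + 1), by positivity, fun u v => ?_⟩
  have hu := waveEnergy_ne_top s β u
  have hv := waveEnergy_ne_top σ b₂ v
  rw [waveNorm_eq_sqrt_waveEnergy _ _ (measurable_fourier_mul u v),
    waveNorm_eq_sqrt_waveEnergy _ _ (measurable_fourier u),
    waveNorm_eq_sqrt_waveEnergy _ _ (measurable_fourier v), ← sqrt_mul (by positivity),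
    ← sqrt_mul (by positivity), mul_assoc]
  refine sqrt_le_sqrt (le_trans (ENNReal.toReal_mono (by finiteness) (h u v)) ?_)
  rw [ENNReal.toReal_mul, ENNReal.toReal_mul]
  gcongr
  linarith

theorem nullphi_high_estimate_3 (s s' θ₀ θ₁ : ℝ)
    (hs1 : 1/4 < s') (hs2 : s' ≤ 1) (hs3 : 1/2 < s) (hs4 : s ≤ 1)
    (hs5 : max (3/2 - 2 * s) (s/2 - 1/8) < s') (hs6 : s' < 4 * s - 3/2)
    (hθ0 : 1/2 < θ₀) (hθ0b : θ₀ < 3/4)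
    (hθ1 : max (1/2) (1 - s') < θ₁)
    (hθ1b : θ₁ < min (3/4) (min (4 * s - s' - 1) (2 * s - 1/2))) :
    ∃ ε₀ > 0, ∀ ε : ℝ, 0 < ε → ε ≤ ε₀ → ∃ C > 0, ∀ u v : SchwartzMap SpaceTime ℂ,
      waveNorm (s - 1/2) (θ₀ - 1 + ε) (fun x => u x * v x) ≤
        C * waveNorm (s - 1/2) θ₀ (fun x => u x) *
          waveNorm (s' + 1/2) (θ₁ - 1/2) (fun x => v x) := by
  rw [max_lt_iff] at hθ1
  have hθ1' := (lt_min_iff.1 hθ1b).1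
  obtain ⟨b, hb, hb1⟩ := exists_between (max_lt (by norm_num : (0 : ℝ) < 1 / 4)
    (by linarith : 1 / 2 - s' < 1 / 4))
  rw [max_lt_iff] at hb
  refine ⟨3 / 4 - θ₀, by linarith, fun ε hε0 hε => ?_⟩
  rw [show θ₀ - 1 + ε = -(1 - θ₀ - ε) by ring]
  exact exists_waveNorm_mul_le (b := b) (by linarith) (by linarith) hθ0 (by linarith) (by linarith)
    (by linarith) hb.1 hb1 (by linarith) (by linarith)

end
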